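/- arXiv:2312.03929 — 2 statements merged into one kernel-verified Lean document; each statement's English description precedes it below -/
import Mathlib

section
/- Let G₊ and G₋ be Stieltjes measures, let a₁⁺, a₂⁺, a₁⁻, a₂⁻ ≥ 0, σ² ≥ 0 and μ ∈ ℝ, and define for ξ ∈ ℂ ∖ iℝ the function ψ(ξ) = (a₂⁺ξ² − i a₁⁺ξ) · ST(G₊)(−iξ) + (a₂⁻ξ² + i a₁⁻ξ) · ST(G₋)(iξ) + (σ²/2)ξ² − iμξ (which is well defined since −iξ, iξ ∉ (−∞, 0] when Re ξ ≠ 0). Then for every q > 0 the equation q + ψ(ξ) = 0 has no solution ξ with Re ξ ≠ 0; i.e., for a Stieltjes–Lévy process, all zeros of q + ψ lie on the imaginary axis. -/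
open Complex MeasureTheory Set Filter Real

noncomputable section

/-- The Stieltjes transform `ST(G)(z) = ∫ (z + s)⁻¹ dG(s)`. -/
def stieltjesTransform (G : Measure ℝ) (z : ℂ) : ℂ := ∫ s : ℝ, ((z + (s : ℂ))⁻¹) ∂G

/-- The characteristic exponent of a Stieltjes–Lévy process. -/
def SLexponent (Gp Gm : Measure ℝ) (a1p a2p a1m a2m σ2 μ : ℝ) (ξ : ℂ) : ℂ :=
  ((a2p : ℂ) * ξ ^ 2 - Complex.I * a1p * ξ) * stieltjesTransform Gp (-Complex.I * ξ) +
    ((a2m : ℂ) * ξ ^ 2 + Complex.I * a1m * ξ) * stieltjesTransform Gm (Complex.I * ξ) +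
    ((σ2 : ℂ) / 2) * ξ ^ 2 - Complex.I * μ * ξ

/-- If the imaginary part of `f` has almost everywhere the same sign as `c`, so does the imaginary
part of its integral. -/
theorem mul_integral_im_nonneg {α : Type*} [MeasurableSpace α] {G : Measure α} {f : α → ℂ} {c : ℝ}
    (hf : ∀ᵐ x ∂G, 0 ≤ c * (f x).im) : 0 ≤ c * (∫ x, f x ∂G).im := by
  by_cases hint : Integrable f G
  · have him : (∫ x, f x ∂G).im = ∫ x, (f x).im ∂G := (integral_im hint).symm
    rw [him, ← integral_const_mul]
    exact integral_nonneg_of_ae hf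
  · simp [integral_undef hint]

/-- The imaginary parts of `z` and of its Stieltjes transform have opposite signs. -/
theorem im_mul_stieltjesTransform_im_nonpos (G : Measure ℝ) (z : ℂ) :
    z.im * (stieltjesTransform G z).im ≤ 0 := by
  have h : 0 ≤ -z.im * (stieltjesTransform G z).im := by
    refine mul_integral_im_nonneg (ae_of_all _ fun s => ?_)
    have him : -z.im * ((z + (s : ℂ))⁻¹).im = z.im ^ 2 / normSq (z + s) := by
      simp [Complex.inv_im]
      ring
    rw [him]
    exact div_nonneg (sq_nonneg _) (normSq_nonneg _)
  linarith

/-- For a measure on `(0, ∞)`, the imaginary parts of `z` and of `z * ST(G)(z)` have the same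
sign. -/
theorem im_mul_self_mul_stieltjesTransform_im_nonneg {G : Measure ℝ} (hG : G (Set.Iic 0) = 0)
    (z : ℂ) : 0 ≤ z.im * (z * stieltjesTransform G z).im := by
  rw [stieltjesTransform, ← integral_const_mul]
  refine mul_integral_im_nonneg ?_
  have hpos : ∀ᵐ s ∂G, 0 < s := by
    rw [ae_iff]
    simp only [not_lt]
    exact hG
  filter_upwards [hpos] with s hs
  have him : z.im * (z * (z + (s : ℂ))⁻¹).im = z.im ^ 2 * s / normSq (z + s) := by
    simp [Complex.inv_im, Complex.inv_re, Complex.mul_im]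
    ring
  rw [him]
  exact div_nonneg (mul_nonneg (sq_nonneg _) hs.le) (normSq_nonneg _)

/-- In the variable `z = -iξ`, the quotient `(q + ψ(ξ)) / z` is a combination of Stieltjes
transforms whose imaginary part has the sign opposite to that of `z`. -/
theorem add_SLexponent_eq_mul (Gp Gm : Measure ℝ) (a1p a2p a1m a2m σ2 μ q : ℝ) {z : ℂ}
    (hz : z ≠ 0) :
    (q : ℂ) + SLexponent Gp Gm a1p a2p a1m a2m σ2 μ (Complex.I * z) =
      z * (q * z⁻¹ + a1p * stieltjesTransform Gp z - a2p * (z * stieltjesTransform Gp z)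
        - a1m * stieltjesTransform Gm (-z) + a2m * (-z * stieltjesTransform Gm (-z))
        - ((σ2 / 2 : ℝ) : ℂ) * z + μ) := by
  have hp : -Complex.I * (Complex.I * z) = z := by linear_combination -z * Complex.I_mul_I
  have hm : Complex.I * (Complex.I * z) = -z := by linear_combination z * Complex.I_mul_I
  have hinv : z * (q * z⁻¹) = q := by field_simp
  rw [SLexponent, hp, hm]
  push_cast
  linear_combination (a2p * z ^ 2 * stieltjesTransform Gp z - a1p * z * stieltjesTransform Gp z
    + a2m * z ^ 2 * stieltjesTransform Gm (-z) + a1m * z * stieltjesTransform Gm (-z)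
    + σ2 / 2 * z ^ 2 - μ * z) * Complex.I_sq - hinv

/-- For a Stieltjes–Lévy process, for every `q > 0` the equation `q + ψ(ξ) = 0` has no
solution off the imaginary axis. -/
theorem SLexponent_no_zeros_off_imaginary_axis
    (Gp Gm : Measure ℝ)
    (hGpSupp : Gp (Set.Iic 0) = 0) (hGmSupp : Gm (Set.Iic 0) = 0)
    (hGpInt : ∫⁻ s : ℝ, ENNReal.ofReal ((1 + s)⁻¹) ∂Gp ≠ ⊤)
    (hGmInt : ∫⁻ s : ℝ, ENNReal.ofReal ((1 + s)⁻¹) ∂Gm ≠ ⊤)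
    (a1p a2p a1m a2m σ2 μ : ℝ)
    (ha1p : 0 ≤ a1p) (ha2p : 0 ≤ a2p) (ha1m : 0 ≤ a1m) (ha2m : 0 ≤ a2m) (hσ2 : 0 ≤ σ2) :
    ∀ q : ℝ, 0 < q → ∀ ξ : ℂ, ξ.re ≠ 0 →
      (q : ℂ) + SLexponent Gp Gm a1p a2p a1m a2m σ2 μ ξ ≠ 0 := by
  intro q hq ξ hξ hzero
  obtain ⟨z, rfl⟩ : ∃ z, ξ = Complex.I * z :=
    ⟨-Complex.I * ξ, by linear_combination ξ * Complex.I_mul_I⟩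
  have him : z.im ≠ 0 := by simpa using hξ
  have hz : z ≠ 0 := fun h => him (by simp [h])
  rw [add_SLexponent_eq_mul _ _ _ _ _ _ _ _ _ hz, mul_eq_zero, or_iff_right hz] at hzero
  have hsum := congrArg Complex.im hzero
  simp only [Complex.add_im, Complex.sub_im, Complex.im_ofReal_mul, Complex.ofReal_im,
    Complex.zero_im] at hsum
  have hinv : z.im * (z⁻¹).im < 0 := by
    have h : z.im * (z⁻¹).im = -(z.im ^ 2 / normSq z) := by
      rw [Complex.inv_im]
      ring
    rw [h]
    exact neg_lt_zero.mpr (div_pos (by positivity) (normSq_pos.mpr hz))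
  have hSp := im_mul_stieltjesTransform_im_nonpos Gp z
  have hSm := im_mul_stieltjesTransform_im_nonpos Gm (-z)
  have hzSp := im_mul_self_mul_stieltjesTransform_im_nonneg hGpSupp z
  have hzSm := im_mul_self_mul_stieltjesTransform_im_nonneg hGmSupp (-z)
  rw [Complex.neg_im] at hSm hzSm
  have h0 := mul_neg_of_pos_of_neg hq hinv
  have h1 := mul_nonpos_of_nonneg_of_nonpos ha1p hSp
  have h2 := mul_nonneg ha2p hzSp
  have h3 := mul_nonpos_of_nonneg_of_nonpos ha1m hSm
  have h4 := mul_nonneg ha2m hzSm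
  have h5 := mul_nonneg hσ2 (sq_nonneg z.im)
  refine lt_irrefl (0 : ℝ) ?_
  linear_combination h0 + h1 + h2 + h3 + h4 + h5 / 2 - z.im * hsum
end
end

section
/- Let c > 0, ν > 0, ζ > 0 and let N be a positive integer such that c·ν·e^{ν N ζ} ≥ 2. Then the truncation error of the trapezoid sum of double-exponentially decaying terms satisfies ζ · ∑_{j = N+1}^{∞} exp(jζ − c e^{ν j ζ}) ≤ exp(Nζ − c e^{ν N ζ}) / (c·ν·e^{ν N ζ} − 1). -/
open Real Filter

/-- Beyond `x * ζ`, the double-exponential terms are dominated by a geometric sequence. -/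
lemma exp_sub_exp_le_geometric (c ν ζ x : ℝ) (hc : 0 ≤ c) (j : ℕ) :
    Real.exp ((x + 1 + j) * ζ - c * Real.exp (ν * (x + 1 + j) * ζ)) ≤
      Real.exp (x * ζ - c * Real.exp (ν * x * ζ)) *
        (Real.exp (-((c * ν * Real.exp (ν * x * ζ) - 1) * ζ)) *
          Real.exp (-((c * ν * Real.exp (ν * x * ζ) - 1) * ζ)) ^ j) := by
  rw [← Real.exp_nat_mul, ← Real.exp_add, ← Real.exp_add, Real.exp_le_exp]
  have hsplit : Real.exp (ν * (x + 1 + j) * ζ) =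
      Real.exp (ν * x * ζ) * Real.exp (ν * (1 + j) * ζ) := by
    rw [← Real.exp_add]
    ring_nf
  have htangent := mul_le_mul_of_nonneg_left (Real.add_one_le_exp (ν * (1 + j) * ζ))
    (mul_nonneg hc (Real.exp_pos (ν * x * ζ)).le)
  rw [hsplit]
  linarith

/-- For `t > 0`, the geometric series `∑ exp (-t) ^ (j + 1)` is at most `1 / t`. -/
lemma exp_neg_mul_inv_one_sub_le (t : ℝ) (ht : 0 < t) :
    Real.exp (-t) * (1 - Real.exp (-t))⁻¹ ≤ 1 / t := by
  have hlt : Real.exp (-t) < 1 := Real.exp_lt_one_iff.mpr (by linarith)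
  rw [← div_eq_mul_inv, div_le_div_iff₀ (by linarith) ht]
  have hmul : Real.exp (-t) * Real.exp t = 1 := by rw [← Real.exp_add]; simp
  have := mul_le_mul_of_nonneg_left (Real.add_one_le_exp t) (Real.exp_pos (-t)).le
  linarith

/-- Truncation error of the trapezoid sum of double-exponentially decaying terms. -/
theorem truncation_error_double_exponential
    (c ν ζ : ℝ) (hc : 0 < c) (hν : 0 < ν) (hζ : 0 < ζ)
    (N : ℕ) (hN : 0 < N) (h : 2 ≤ c * ν * Real.exp (ν * N * ζ)) :
    Summable (fun j : ℕ =>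
      Real.exp (((N : ℝ) + 1 + j) * ζ - c * Real.exp (ν * ((N : ℝ) + 1 + j) * ζ))) ∧
    ζ * ∑' j : ℕ,
        Real.exp (((N : ℝ) + 1 + j) * ζ - c * Real.exp (ν * ((N : ℝ) + 1 + j) * ζ))
      ≤ Real.exp ((N : ℝ) * ζ - c * Real.exp (ν * N * ζ)) /
          (c * ν * Real.exp (ν * N * ζ) - 1) := by
  set A := c * ν * Real.exp (ν * N * ζ) - 1
  set B := Real.exp ((N : ℝ) * ζ - c * Real.exp (ν * N * ζ))
  have hApos : 0 < A := by linarith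
  have ht : 0 < A * ζ := mul_pos hApos hζ
  have hlt : Real.exp (-(A * ζ)) < 1 := Real.exp_lt_one_iff.mpr (by linarith)
  have hle := exp_sub_exp_le_geometric c ν ζ N hc.le
  have hgeom := ((hasSum_geometric_of_lt_one (Real.exp_pos _).le hlt).mul_left
    (Real.exp (-(A * ζ)))).mul_left B
  have hsum := Summable.of_nonneg_of_le (fun _ => (Real.exp_pos _).le) hle hgeom.summable
  refine ⟨hsum, ?_⟩
  calc _ ≤ ζ * (B * (Real.exp (-(A * ζ)) * (1 - Real.exp (-(A * ζ)))⁻¹)) :=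
        mul_le_mul_of_nonneg_left (hasSum_le hle hsum.hasSum hgeom) hζ.le
    _ ≤ ζ * (B * (1 / (A * ζ))) := by
        gcongr
        exact exp_neg_mul_inv_one_sub_le _ ht
    _ = B / A := by field_simp
end
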